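/- arXiv:2108.10124 — 3 statements merged into one kernel-verified Lean document; each statement's English description precedes it below -/
import Mathlib

section
/- Let x^(1),...,x^(m) ∈ ℝ^n each have first coordinate 0, let F ∈ ℝ^n with F_1 = 0 be a tropical Fermat–Weber point of x^(1),...,x^(m), and set x^(m+1) := F. Let t be the minimum of all coordinates of x^(1),...,x^(m+1), fix 2 ≤ d1 < d2 ≤ n, and form the projected rows p^(1),...,p^(m+1) of x^(1),...,x^(m+1). Let u^(1), u^(2), u^(3) be built from x^(1),...,x^(m+1), d1, d2 and t as below, and C = tconv{u^(1), u^(2), u^(3)}. If p^(m+1) is a tropical Fermat–Weber point of p^(1),...,p^(m+1), then δ_C(F) is a tropical Fermat–Weber point of δ_C(x^(1)),...,δ_C(x^(m+1)). -/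
/-- Tropical distance on `ℝ^n`. -/
noncomputable def dtr {n : ℕ} (u v : Fin n → ℝ) : ℝ :=
  (⨆ i, (u i - v i)) - (⨅ i, (u i - v i))

/-- The first vertex `u^(1)`: `u 0 = 0`, `u d1 = min_k x k d1 - 1`,
`u d2 = min_k x k d2 - 1`, and `u j = t` elsewhere. -/
noncomputable def mkU1 {m n : ℕ} [NeZero n] (x : Fin m → Fin n → ℝ)
    (d1 d2 : Fin n) (t : ℝ) : Fin n → ℝ :=
  fun j => if j = 0 then 0 else if j = d1 then (⨅ k, x k d1) - 1
    else if j = d2 then (⨅ k, x k d2) - 1 else t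

/-- The second vertex `u^(2)`: `u 0 = 0`, `u d1 = min_k x k d1 + 1`,
`u d2 = max_k x k d2 + 1`, and `u j = t` elsewhere. -/
noncomputable def mkU2 {m n : ℕ} [NeZero n] (x : Fin m → Fin n → ℝ)
    (d1 d2 : Fin n) (t : ℝ) : Fin n → ℝ :=
  fun j => if j = 0 then 0 else if j = d1 then (⨅ k, x k d1) + 1
    else if j = d2 then (⨆ k, x k d2) + 1 else t

/-- The third vertex `u^(3)`: `u 0 = 0`, `u d1 = max_k x k d1 + 1`,
`u d2 = min_k x k d2 + 1`, and `u j = t` elsewhere. -/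
noncomputable def mkU3 {m n : ℕ} [NeZero n] (x : Fin m → Fin n → ℝ)
    (d1 d2 : Fin n) (t : ℝ) : Fin n → ℝ :=
  fun j => if j = 0 then 0 else if j = d1 then (⨆ k, x k d1) + 1
    else if j = d2 then (⨅ k, x k d2) + 1 else t

/-- Tropical projection onto the tropical convex hull of three points. -/
noncomputable def proj3 {n : ℕ} (u1 u2 u3 : Fin n → ℝ) (x : Fin n → ℝ) : Fin n → ℝ :=
  fun j => max ((⨅ ℓ, (x ℓ - u1 ℓ)) + u1 j)
    (max ((⨅ ℓ, (x ℓ - u2 ℓ)) + u2 j) ((⨅ ℓ, (x ℓ - u3 ℓ)) + u3 j))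

theorem ciInf_eq_of_forall_apply_le {ι : Type*} {f : ι → ℝ} (i : ι) (h : ∀ j, f i ≤ f j) :
    ⨅ j, f j = f i :=
  IsLeast.csInf_eq ⟨⟨i, rfl⟩, by rintro _ ⟨j, rfl⟩; exact h j⟩

/-- Projecting a row of the family onto the special tropical triangle keeps the coordinates
`0`, `d1`, `d2` and replaces all the others by `t`. -/
theorem proj3_mkU_eq {n m : ℕ} [NeZero n] {d1 d2 : Fin n} (hd1 : d1 ≠ 0) (hd2 : d2 ≠ 0)
    (hd12 : d1 ≠ d2) (x : Fin m → Fin n → ℝ) (t : ℝ) (k : Fin m) (hx0 : x k 0 = 0)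
    (ht : ∀ j, t ≤ x k j) (j : Fin n) :
    proj3 (mkU1 x d1 d2 t) (mkU2 x d1 d2 t) (mkU3 x d1 d2 t) (x k) j =
      if j = 0 then 0 else if j = d1 then x k d1 else if j = d2 then x k d2 else t := by
  have hA (d : Fin n) : ⨅ i, x i d ≤ x k d := ciInf_le (Set.finite_range _).bddBelow k
  have hB (d : Fin n) : x k d ≤ ⨆ i, x i d :=
    le_ciSup (f := fun i => x i d) (Set.finite_range _).bddAbove k
  have hA1 := hA d1
  have hA2 := hA d2
  have hB1 := hB d1
  have hB2 := hB d2
  have h1 : ⨅ l, (x k l - mkU1 x d1 d2 t l) = 0 := by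
    rw [ciInf_eq_of_forall_apply_le 0]
    · simp [mkU1, hx0]
    · intro l
      have := ht l
      simp only [mkU1]
      grind
  have h2 : ⨅ l, (x k l - mkU2 x d1 d2 t l) = x k d2 - (⨆ i, x i d2) - 1 := by
    rw [ciInf_eq_of_forall_apply_le d2]
    · simp only [mkU2]
      grind
    · intro l
      have := ht l
      simp only [mkU2]
      grind
  have h3 : ⨅ l, (x k l - mkU3 x d1 d2 t l) = x k d1 - (⨆ i, x i d1) - 1 := by
    rw [ciInf_eq_of_forall_apply_le d1]
    · simp only [mkU3]
      grind
    · intro l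
      have := ht l
      simp only [mkU3]
      grind
  rw [proj3, h1, h2, h3]
  simp only [mkU1, mkU2, mkU3]
  grind

/-- Let `F` be a Fermat–Weber point of `x 1, …, x m`, let `x'` be the
augmented family, `t` the minimum of all coordinates of `x'`, and `p k` the
projected rows. If the last projected row `p (m+1)` is a Fermat–Weber point of
`p 1, …, p (m+1)`, then the projection `δ_C(F)` onto the special tropical
triangle `C` is a Fermat–Weber point of `δ_C(x' 1), …, δ_C(x' (m+1))`. -/
theorem projection_of_fermat_weber {n m : ℕ} [NeZero n] (hn : 3 ≤ n) (hm : 1 ≤ m)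
    (d1 d2 : Fin n) (hd1 : (0 : Fin n) < d1) (hd12 : d1 < d2)
    (x : Fin m → Fin n → ℝ) (hx0 : ∀ k, x k 0 = 0)
    (F : Fin n → ℝ) (hF0 : F 0 = 0)
    (hFW : ∀ z : Fin n → ℝ, ∑ i, dtr F (x i) ≤ ∑ i, dtr z (x i))
    (x' : Fin (m + 1) → Fin n → ℝ) (hx' : x' = Fin.snoc x F)
    (t : ℝ) (ht : t = ⨅ k, ⨅ j, x' k j)
    (p : Fin (m + 1) → Fin n → ℝ)
    (hp : ∀ k j, p k j =
      if j = 0 then 0 else if j = d1 then x' k d1 else if j = d2 then x' k d2 else t)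
    (hlast : ∀ z : Fin n → ℝ, ∑ k, dtr (p (Fin.last m)) (p k) ≤ ∑ k, dtr z (p k)) :
    ∀ z : Fin n → ℝ,
      ∑ k, dtr (proj3 (mkU1 x' d1 d2 t) (mkU2 x' d1 d2 t) (mkU3 x' d1 d2 t) F)
          (proj3 (mkU1 x' d1 d2 t) (mkU2 x' d1 d2 t) (mkU3 x' d1 d2 t) (x' k)) ≤
        ∑ k, dtr z (proj3 (mkU1 x' d1 d2 t) (mkU2 x' d1 d2 t) (mkU3 x' d1 d2 t) (x' k)) := by
  have hx'0 (k : Fin (m + 1)) : x' k 0 = 0 := by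
    subst hx'
    refine Fin.lastCases ?_ (fun i => ?_) k
    · simpa using hF0
    · simpa using hx0 i
  have hle (k : Fin (m + 1)) (j : Fin n) : t ≤ x' k j := by
    rw [ht]
    exact (ciInf_le (Set.finite_range _).bddBelow k).trans
      (ciInf_le (Set.finite_range _).bddBelow j)
  have hproj (k : Fin (m + 1)) :
      proj3 (mkU1 x' d1 d2 t) (mkU2 x' d1 d2 t) (mkU3 x' d1 d2 t) (x' k) = p k := by
    funext j
    rw [hp, proj3_mkU_eq hd1.ne' (hd1.trans hd12).ne' hd12.ne x' t k (hx'0 k) (hle k)]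
  have hF : x' (Fin.last m) = F := by simp [hx']
  intro z
  rw [← hF]
  simpa only [hproj] using hlast z
end

section
/- There exists a tropical Fermat–Weber point of the projected rows p^(1),...,p^(m) of the special form r ∈ ℝ^n with r_1 = 0, r_j = t for every j ∉ {1, d1, d2}, and arbitrary real values at coordinates d1 and d2; i.e., some Fermat–Weber point of p^(1),...,p^(m) equals t at all coordinates outside {1, d1, d2} and 0 at the first coordinate. -/
theorem sub_sub_sub_le_dtr {n : ℕ} (u v : Fin n → ℝ) (i j : Fin n) :
    (u i - v i) - (u j - v j) ≤ dtr u v :=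
  sub_le_sub (le_ciSup (f := fun i => u i - v i) (Set.finite_range _).bddAbove i)
    (ciInf_le (f := fun i => u i - v i) (Set.finite_range _).bddBelow j)

theorem dtr_le_of_forall {n : ℕ} [NeZero n] {u v : Fin n → ℝ} {c : ℝ}
    (h : ∀ i j, (u i - v i) - (u j - v j) ≤ c) : dtr u v ≤ c := by
  obtain ⟨i, hi⟩ := exists_eq_ciSup_of_finite (f := fun i => u i - v i)
  obtain ⟨j, hj⟩ := exists_eq_ciInf_of_finite (f := fun i => u i - v i)
  have := h i j
  simp only [dtr, ← hi, ← hj]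
  exact this

theorem dtr_nonneg {n : ℕ} [NeZero n] (u v : Fin n → ℝ) : 0 ≤ dtr u v := by
  simpa using sub_sub_sub_le_dtr u v 0 0

theorem continuous_dtr_left {n : ℕ} [NeZero n] (v : Fin n → ℝ) :
    Continuous fun u : Fin n → ℝ => dtr u v := by
  simp only [dtr, ← Finset.sup'_univ_eq_ciSup, ← Finset.inf'_univ_eq_ciInf]
  exact (Continuous.finset_sup'_apply _ fun i _ => by fun_prop).sub
    (Continuous.finset_inf'_apply _ fun i _ => by fun_prop)

/-- If all points of a family agree with `q` on a nonempty set `S` of coordinates, then every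
point can be moved to one which agrees with `q` on `S`, without increasing its tropical distance
to any point of the family. -/
theorem exists_eqOn_forall_dtr_le {n : ℕ} [NeZero n] {ι : Type*} {p : ι → Fin n → ℝ}
    {S : Finset (Fin n)} (hS : S.Nonempty) {q : Fin n → ℝ} (hq : ∀ k, ∀ j ∈ S, p k j = q j)
    (z : Fin n → ℝ) :
    ∃ r : Fin n → ℝ, (∀ j ∈ S, r j = q j) ∧ ∀ k, dtr r (p k) ≤ dtr z (p k) := by
  obtain ⟨s, hs, hmin⟩ := S.exists_min_image (fun j => z j - q j) hS
  set c := z s - q s with hc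
  refine ⟨fun j => if j ∈ S then q j else z j - c, fun j hj => if_pos hj, fun k => ?_⟩
  refine dtr_le_of_forall fun i j => ?_
  have upper : (if i ∈ S then q i else z i - c) - p k i ≤ z i - p k i - c := by
    split_ifs with hi
    · have := hmin i hi
      rw [hq k i hi]
      linarith
    · linarith
  have lower : ∃ l, (if j ∈ S then q j else z j - c) - p k j = z l - p k l - c := by
    split_ifs with hj
    · exact ⟨s, by rw [hq k j hj, hq k s hs, hc]; ring⟩
    · exact ⟨j, by ring⟩
  obtain ⟨l, hl⟩ := lower
  have := sub_sub_sub_le_dtr z (p k) i l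
  linarith

/-- The sum of tropical distances to a nonempty finite family attains its minimum on the set of
points with prescribed values on a nonempty set of coordinates. -/
theorem exists_forall_sum_dtr_le_of_eqOn {n : ℕ} [NeZero n] {ι : Type*} [Fintype ι] [Nonempty ι]
    (p : ι → Fin n → ℝ) {S : Finset (Fin n)} (hS : S.Nonempty) {q : Fin n → ℝ}
    (hq : ∀ k, ∀ j ∈ S, p k j = q j) :
    ∃ r : Fin n → ℝ, (∀ j ∈ S, r j = q j) ∧ ∀ z : Fin n → ℝ, (∀ j ∈ S, z j = q j) →
      ∑ k, dtr r (p k) ≤ ∑ k, dtr z (p k) := by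
  obtain ⟨k₀⟩ := ‹Nonempty ι›
  obtain ⟨s, hs⟩ := hS
  have hclosed : IsClosed {z : Fin n → ℝ | ∀ j ∈ S, z j = q j} := by
    simp only [Set.ofPred_forall]
    exact isClosed_biInter fun j _ => isClosed_eq (continuous_apply j) continuous_const
  have hcont : Continuous fun z : Fin n → ℝ => ∑ k, dtr z (p k) :=
    continuous_finsetSum _ fun k _ => continuous_dtr_left (p k)
  set M := ∑ k, dtr (p k₀) (p k)
  have hM₀ : 0 ≤ M := Finset.sum_nonneg fun k _ => dtr_nonneg _ _
  obtain ⟨r, ⟨-, hrS⟩, hr⟩ := ((isCompact_closedBall (p k₀) M).inter_right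
    hclosed).exists_isMinOn ⟨p k₀, Metric.mem_closedBall_self hM₀, hq k₀⟩ hcont.continuousOn
  refine ⟨r, hrS, fun z hz => ?_⟩
  by_cases hzM : ∑ k, dtr z (p k) ≤ M
  · refine hr ⟨?_, hz⟩
    refine (dist_pi_le_iff hM₀).2 fun j => ?_
    have hle : dtr z (p k₀) ≤ ∑ k, dtr z (p k) :=
      Finset.single_le_sum (f := fun k => dtr z (p k)) (fun k _ => dtr_nonneg _ _)
        (Finset.mem_univ k₀)
    have hsj := sub_sub_sub_le_dtr z (p k₀) s j
    have hjs := sub_sub_sub_le_dtr z (p k₀) j s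
    rw [hz s hs, hq k₀ s hs] at hsj hjs
    rw [Real.dist_eq, abs_le]
    constructor <;> linarith
  · exact (hr ⟨Metric.mem_closedBall_self hM₀, hq k₀⟩).trans (not_le.1 hzM).le

/-- There exists a Fermat–Weber point of the projected rows `p 1, …, p m`
of the special form: `0` at the first coordinate and `t` at every coordinate
outside `{1, d1, d2}`. -/
theorem exists_special_fermat_weber {n m : ℕ} [NeZero n] (hn : 3 ≤ n) (hm : 1 ≤ m)
    (d1 d2 : Fin n) (hd1 : (0 : Fin n) < d1) (hd12 : d1 < d2)
    (x : Fin m → Fin n → ℝ) (hx0 : ∀ k, x k 0 = 0)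
    (t : ℝ) (ht : t = ⨅ k, ⨅ j, x k j)
    (p : Fin m → Fin n → ℝ)
    (hp : ∀ k j, p k j =
      if j = 0 then 0 else if j = d1 then x k d1 else if j = d2 then x k d2 else t) :
    ∃ r : Fin n → ℝ, r 0 = 0 ∧
      (∀ j : Fin n, j ≠ 0 → j ≠ d1 → j ≠ d2 → r j = t) ∧
      ∀ z : Fin n → ℝ, ∑ i, dtr r (p i) ≤ ∑ i, dtr z (p i) := by
  have : Nonempty (Fin m) := ⟨⟨0, hm⟩⟩
  let S : Finset (Fin n) := Finset.univ.filter fun j => j ≠ d1 ∧ j ≠ d2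
  let q : Fin n → ℝ := fun j => if j = 0 then 0 else t
  have h0 : (0 : Fin n) ∈ S := by simp [S, hd1.ne, (hd1.trans hd12).ne]
  have hq : ∀ k, ∀ j ∈ S, p k j = q j := by
    intro k j hj
    obtain ⟨h1, h2⟩ : j ≠ d1 ∧ j ≠ d2 := by simpa [S] using hj
    simp [hp, q, h1, h2]
  obtain ⟨r, hrS, hr⟩ := exists_forall_sum_dtr_le_of_eqOn p ⟨0, h0⟩ hq
  refine ⟨r, by simpa [q] using hrS 0 h0, fun j hj h1 h2 => ?_, fun z => ?_⟩
  · simpa [q, hj] using hrS j (by simp [S, h1, h2])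
  · obtain ⟨w, hwS, hw⟩ := exists_eqOn_forall_dtr_le ⟨0, h0⟩ hq z
    exact (hr w hwS).trans (Finset.sum_le_sum fun k _ => hw k)
end

section
/- Let f ∈ ℝ^n with f_1 = 0, and define r ∈ ℝ^n by r_1 = 0, r_{d1} = f_{d1}, r_{d2} = f_{d2}, and r_j = t for every j ∉ {1, d1, d2}. Then d_tr(p^(i), f) ≥ d_tr(p^(i), r) for every i ∈ {1,...,m}, and consequently Σ_{i=1}^m d_tr(p^(i), f) ≥ Σ_{i=1}^m d_tr(p^(i), r). -/
/-- If every coordinate of `u - v` is also a coordinate of `u' - v'`, then `u, v` are at most as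
far apart as `u', v'` in the tropical distance. -/
theorem dtr_le_dtr_of_forall_exists {n : ℕ} [NeZero n] {u v u' v' : Fin n → ℝ}
    (h : ∀ j, ∃ k, u j - v j = u' k - v' k) : dtr u v ≤ dtr u' v' := by
  refine sub_le_sub (ciSup_le fun j => ?_) (le_ciInf fun j => ?_) <;> obtain ⟨k, hk⟩ := h j <;>
    rw [hk]
  · exact le_ciSup (f := fun i => u' i - v' i) (Set.finite_range _).bddAbove k
  · exact ciInf_le (f := fun i => u' i - v' i) (Set.finite_range _).bddBelow k

/-- For `f` with `f 0 = 0` and `r` the point agreeing with `f` at coordinates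
`d1, d2`, equal to `0` at the first coordinate and to `t` elsewhere:
`d_tr(p i, f) ≥ d_tr(p i, r)` for every `i`, and hence
`∑ i, d_tr(p i, f) ≥ ∑ i, d_tr(p i, r)`. -/
theorem flattening_decreases_dist_sum {n m : ℕ} [NeZero n] (hn : 3 ≤ n) (hm : 1 ≤ m)
    (d1 d2 : Fin n) (hd1 : (0 : Fin n) < d1) (hd12 : d1 < d2)
    (x : Fin m → Fin n → ℝ) (hx0 : ∀ k, x k 0 = 0)
    (t : ℝ) (ht : t = ⨅ k, ⨅ j, x k j)
    (p : Fin m → Fin n → ℝ)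
    (hp : ∀ k j, p k j =
      if j = 0 then 0 else if j = d1 then x k d1 else if j = d2 then x k d2 else t)
    (f : Fin n → ℝ) (hf0 : f 0 = 0)
    (r : Fin n → ℝ)
    (hr : ∀ j, r j =
      if j = 0 then 0 else if j = d1 then f d1 else if j = d2 then f d2 else t) :
    (∀ i : Fin m, dtr (p i) r ≤ dtr (p i) f) ∧
    ∑ i, dtr (p i) r ≤ ∑ i, dtr (p i) f := by
  have h (i : Fin m) : dtr (p i) r ≤ dtr (p i) f := by
    refine dtr_le_dtr_of_forall_exists fun j => ?_
    by_cases hj : j = d1 ∨ j = d2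
    · refine ⟨j, ?_⟩
      rcases hj with rfl | rfl
      · simp [hr, hd1.ne']
      · simp [hr, (hd1.trans hd12).ne', hd12.ne']
    · refine ⟨0, ?_⟩
      simp only [not_or] at hj
      simp [hp, hr, hf0, hj.1, hj.2]
  exact ⟨h, Finset.sum_le_sum fun i _ => h i⟩
end
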